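/- Let (X, 𝒰, ∫) be a Daniell space. For every sequence (f_n) in 𝒰* that is non-increasing pointwise and satisfies f_n(x) → 0 for every x ∈ X, one has ∫f_n → 0. -/

import Mathlib

open Filter Topology

/-- A Daniell space: a Riesz space `U` of real-valued functions on `X` together with a
positive linear functional `integral` satisfying the Daniell continuity condition (II). -/
structure DaniellSpace (X : Type*) where
  U : Set (X → ℝ)
  integral : (X → ℝ) → ℝ
  zero_mem : (0 : X → ℝ) ∈ U
  add_mem : ∀ {f g : X → ℝ}, f ∈ U → g ∈ U → f + g ∈ U
  smul_mem : ∀ (c : ℝ) {f : X → ℝ}, f ∈ U → c • f ∈ U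
  sup_mem : ∀ {f g : X → ℝ}, f ∈ U → g ∈ U → f ⊔ g ∈ U
  inf_mem : ∀ {f g : X → ℝ}, f ∈ U → g ∈ U → f ⊓ g ∈ U
  integral_add : ∀ {f g : X → ℝ}, f ∈ U → g ∈ U →
    integral (f + g) = integral f + integral g
  integral_smul : ∀ (c : ℝ) {f : X → ℝ}, f ∈ U → integral (c • f) = c * integral f
  integral_nonneg : ∀ {f : X → ℝ}, f ∈ U → (∀ x, 0 ≤ f x) → 0 ≤ integral f
  integral_tendsto_zero : ∀ f : ℕ → X → ℝ, (∀ n, f n ∈ U) → Antitone f →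
    (∀ x, Tendsto (fun n => f n x) atTop (𝓝 (0 : ℝ))) →
    Tendsto (fun n => integral (f n)) atTop (𝓝 (0 : ℝ))

/-- `f ≃ ∑ fₙ` : the `fₙ` belong to `U`, `∑ ∫|fₙ| < ∞`, and `f x = ∑ fₙ x` at every
point where the series converges absolutely. -/
def DaniellSpace.Rep {X : Type*} (D : DaniellSpace X) (f : X → ℝ) (fs : ℕ → X → ℝ) : Prop :=
  (∀ n, fs n ∈ D.U) ∧ (Summable fun n => D.integral |fs n|) ∧
  ∀ x, (Summable fun n => |fs n x|) → HasSum (fun n => fs n x) (f x)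

/-- The extension `𝒰*` of `𝒰`. -/
def DaniellSpace.Ustar {X : Type*} (D : DaniellSpace X) : Set (X → ℝ) :=
  {f | ∃ fs, D.Rep f fs}

-- The integral on `𝒰*`: `∫ f = ∑ ∫ fₙ` for any representation `f ≃ ∑ fₙ`
-- (the value is independent of the representation).
open Classical in
noncomputable def DaniellSpace.integralStar {X : Type*} (D : DaniellSpace X)
    (f : X → ℝ) : ℝ :=
  if h : ∃ fs, D.Rep f fs then ∑' n, D.integral (h.choose n) else 0

/-- A Daniell space is complete if `f ≃ ∑ fₙ` with all `fₙ ∈ 𝒰` implies `f ∈ 𝒰`. -/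
def DaniellSpace.Complete {X : Type*} (D : DaniellSpace X) : Prop :=
  ∀ (f : X → ℝ) (fs : ℕ → X → ℝ), D.Rep f fs → f ∈ D.U

/-- A null set: its characteristic function is a null function. -/
def DaniellSpace.NullSet {X : Type*} (D : DaniellSpace X) (S : Set X) : Prop :=
  S.indicator (fun _ => (1 : ℝ)) ∈ D.U ∧ D.integral (S.indicator fun _ => (1 : ℝ)) = 0

namespace DaniellSpace

variable {X : Type*} (D : DaniellSpace X)

lemma neg_mem {f : X → ℝ} (hf : f ∈ D.U) : -f ∈ D.U := by
  simpa using D.smul_mem (-1) hf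

lemma sub_mem {f g : X → ℝ} (hf : f ∈ D.U) (hg : g ∈ D.U) : f - g ∈ D.U := by
  simpa [sub_eq_add_neg] using D.add_mem hf (D.neg_mem hg)

lemma abs_mem {f : X → ℝ} (hf : f ∈ D.U) : |f| ∈ D.U :=
  D.sup_mem hf (D.neg_mem hf)

lemma sum_mem {w : ℕ → X → ℝ} (hw : ∀ n, w n ∈ D.U) (n : ℕ) :
    ∑ i ∈ Finset.range n, w i ∈ D.U := by
  induction n with
  | zero => simpa using D.zero_mem
  | succ n ih => rw [Finset.sum_range_succ]; exact D.add_mem ih (hw n)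

lemma integral_neg {f : X → ℝ} (hf : f ∈ D.U) : D.integral (-f) = -D.integral f := by
  simpa using D.integral_smul (-1) hf

lemma integral_sub {f g : X → ℝ} (hf : f ∈ D.U) (hg : g ∈ D.U) :
    D.integral (f - g) = D.integral f - D.integral g := by
  rw [sub_eq_add_neg, D.integral_add hf (D.neg_mem hg), D.integral_neg hg, sub_eq_add_neg]

lemma integral_mono {f g : X → ℝ} (hf : f ∈ D.U) (hg : g ∈ D.U) (h : f ≤ g) :
    D.integral f ≤ D.integral g := by
  have := D.integral_nonneg (D.sub_mem hg hf) fun x => sub_nonneg.2 (h x)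
  rw [D.integral_sub hg hf] at this
  linarith

lemma abs_integral_le {f : X → ℝ} (hf : f ∈ D.U) : |D.integral f| ≤ D.integral |f| := by
  refine abs_le'.2 ⟨D.integral_mono hf (D.abs_mem hf) (le_abs_self f), ?_⟩
  rw [← D.integral_neg hf]
  exact D.integral_mono (D.neg_mem hf) (D.abs_mem hf) (neg_le_abs f)

lemma integral_sum {w : ℕ → X → ℝ} (hw : ∀ n, w n ∈ D.U) (n : ℕ) :
    D.integral (∑ i ∈ Finset.range n, w i) = ∑ i ∈ Finset.range n, D.integral (w i) := by
  induction n with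
  | zero => simpa using D.integral_smul 0 D.zero_mem
  | succ n ih =>
    rw [Finset.sum_range_succ, D.integral_add (D.sum_mem hw n) (hw n), ih, Finset.sum_range_succ]

/-- If a non-increasing sequence in `U` is asymptotically dominated by a nonnegative series
`∑ wᵢ` wherever the latter converges, then its integrals are asymptotically dominated by
`∑ ∫ wᵢ`. -/
lemma eventually_integral_le {g w : ℕ → X → ℝ} (hg : ∀ n, g n ∈ D.U) (hanti : Antitone g)
    (hw : ∀ n, w n ∈ D.U) (hw0 : ∀ n x, 0 ≤ w n x) (hsum : Summable fun n => D.integral (w n))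
    (hle : ∀ x, (Summable fun n => w n x) → ∀ δ > 0, ∀ᶠ n in atTop, g n x ≤ ∑' i, w i x + δ)
    {δ : ℝ} (hδ : 0 < δ) :
    ∀ᶠ n in atTop, D.integral (g n) ≤ ∑' i, D.integral (w i) + δ := by
  set s : ℕ → X → ℝ := fun n => ∑ i ∈ Finset.range n, w i with hs
  have hsx (n : ℕ) (x : X) : s n x = ∑ i ∈ Finset.range n, w i x := by simp [hs]
  have hsU (n : ℕ) : s n ∈ D.U := D.sum_mem hw n
  have hsmono : Monotone s := monotone_nat_of_le_succ fun n x => by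
    simpa [hsx, Finset.sum_range_succ] using hw0 n x
  have hpU (n : ℕ) : (g n - s n) ⊔ 0 ∈ D.U := D.sup_mem (D.sub_mem (hg n) (hsU n)) D.zero_mem
  have htend := D.integral_tendsto_zero (fun n => (g n - s n) ⊔ 0) hpU
    (fun m n hmn => sup_le_sup_right (sub_le_sub (hanti hmn) (hsmono hmn)) 0) (fun x => by
      rw [Metric.tendsto_nhds]
      intro η hη
      have key : ∀ᶠ n in atTop, g n x - s n x < η := by
        by_cases hx : Summable fun n => w n x
        · filter_upwards [hle x hx (η / 2) (half_pos hη),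
            hx.hasSum.tendsto_sum_nat.eventually (lt_mem_nhds (sub_lt_self _ (half_pos hη)))]
            with n h1 h2
          rw [hsx]
          linarith
        · have := (not_summable_iff_tendsto_nat_atTop_of_nonneg fun n => hw0 n x).1 hx
          filter_upwards [this.eventually_ge_atTop (g 0 x)] with n h1
          have := hanti (Nat.zero_le n) x
          rw [hsx]
          linarith
      filter_upwards [key] with n h1
      have h2 : (0 : ℝ) ≤ max (g n x - s n x) 0 := le_max_right _ _
      simpa [Real.dist_eq, abs_of_nonneg h2, hη] using h1)
  filter_upwards [htend.eventually (gt_mem_nhds hδ)] with n hn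
  have h1 : D.integral (s n) ≤ ∑' i, D.integral (w i) := by
    rw [hs, D.integral_sum hw]
    exact hsum.sum_le_tsum _ fun i _ => D.integral_nonneg (hw i) (hw0 i)
  have h2 : D.integral (g n - s n) ≤ D.integral ((g n - s n) ⊔ 0) :=
    D.integral_mono (D.sub_mem (hg n) (hsU n)) (hpU n) le_sup_left
  rw [D.integral_sub (hg n) (hsU n)] at h2
  linarith

lemma integral_le_tsum {f : X → ℝ} {w : ℕ → X → ℝ} (hf : f ∈ D.U)
    (hw : ∀ n, w n ∈ D.U) (hw0 : ∀ n x, 0 ≤ w n x) (hsum : Summable fun n => D.integral (w n))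
    (hle : ∀ x, (Summable fun n => w n x) → f x ≤ ∑' i, w i x) :
    D.integral f ≤ ∑' i, D.integral (w i) :=
  le_of_forall_pos_le_add fun δ hδ => by
    obtain ⟨n, hn⟩ := (D.eventually_integral_le (fun _ => hf) antitone_const hw hw0 hsum
      (fun x hx η hη => .of_forall fun _ => by linarith [hle x hx]) hδ).exists
    exact hn

/-- Simultaneous approximation of a sequence in `U*` by elements of `U`, with the pointwise
errors controlled by a single nonnegative series in `U` of small integral. -/
lemma exists_approx {fs : ℕ → X → ℝ} (hfs : ∀ n, fs n ∈ D.Ustar) {ε : ℝ} (hε : 0 < ε) :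
    ∃ h w : ℕ → X → ℝ, (∀ n, h n ∈ D.U) ∧ (∀ n, w n ∈ D.U) ∧ (∀ n x, 0 ≤ w n x) ∧
      (Summable fun n => D.integral (w n)) ∧ ∑' n, D.integral (w n) ≤ 2 * ε ∧
      (∀ n, |D.integral (h n) - D.integralStar (fs n)| ≤ ε) ∧
      ∀ x, (Summable fun n => w n x) → ∀ n, |fs n x - h n x| ≤ ∑' i, w i x := by
  have hrep (n : ℕ) : ∃ r, D.Rep (fs n) r ∧ D.integralStar (fs n) = ∑' i, D.integral (r i) := by
    have hex : ∃ r, D.Rep (fs n) r := hfs n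
    exact ⟨hex.choose, hex.choose_spec, by simp only [integralStar, dif_pos hex]⟩
  choose r hr hint using hrep
  have hK (n : ℕ) : ∃ K, ∑' i, D.integral |r n (i + K)| ≤ ε * (1 / 2) ^ n ∧
      |∑ i ∈ Finset.range K, D.integral (r n i) - D.integralStar (fs n)| ≤ ε := by
    have hs : Summable fun i => D.integral (r n i) :=
      Summable.of_norm_bounded (hr n).2.1 fun i => D.abs_integral_le ((hr n).1 i)
    have h1 := (tendsto_sum_nat_add fun i => D.integral |r n i|).eventually
      (gt_mem_nhds (show (0 : ℝ) < ε * (1 / 2) ^ n by positivity))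
    have h2 := (Metric.tendsto_nhds.1 hs.hasSum.tendsto_sum_nat) ε hε
    obtain ⟨K, hK1, hK2⟩ := (h1.and h2).exists
    exact ⟨K, hK1.le, by rw [hint]; exact hK2.le⟩
  choose K hK1 hK2 using hK
  let v : ℕ × ℕ → X → ℝ := fun p => |r p.1 (p.2 + K p.1)|
  have hvU (p : ℕ × ℕ) : v p ∈ D.U := D.abs_mem ((hr p.1).1 _)
  have hv0 (p : ℕ × ℕ) (x : X) : 0 ≤ v p x := abs_nonneg _
  have hgeom : Summable fun n : ℕ => ε * (1 / 2 : ℝ) ^ n := summable_geometric_two.mul_left ε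
  have htail : Summable fun n => ∑' i, D.integral (v (n, i)) :=
    Summable.of_nonneg_of_le
      (fun n => tsum_nonneg fun i => D.integral_nonneg (hvU _) (hv0 _)) hK1 hgeom
  have hvsum : Summable fun p => D.integral (v p) :=
    (summable_prod_of_nonneg fun p => D.integral_nonneg (hvU p) (hv0 p)).2
      ⟨fun n => (summable_nat_add_iff (K n)).2 (hr n).2.1, htail⟩
  let e : ℕ ≃ ℕ × ℕ := Nat.pairEquiv.symm
  refine ⟨fun n => ∑ i ∈ Finset.range (K n), r n i, fun n => v (e n),
    fun n => D.sum_mem (hr n).1 _, fun n => hvU _, fun n => hv0 _,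
    (e.summable_iff (f := fun p => D.integral (v p))).2 hvsum, ?_, fun n => ?_, fun x hx n => ?_⟩
  · rw [e.tsum_eq (fun p => D.integral (v p)), hvsum.tsum_prod]
    calc _ ≤ ∑' n : ℕ, ε * (1 / 2 : ℝ) ^ n := htail.tsum_le_tsum hK1 hgeom
      _ = 2 * ε := by rw [tsum_mul_left, tsum_geometric_two, mul_comm]
  · rw [D.integral_sum (hr n).1]
    exact hK2 n
  · have hvx : Summable fun p => v p x := (e.summable_iff (f := fun p => v p x)).1 hx
    rw [e.tsum_eq (fun p => v p x)]
    have hfib : Summable fun i => |r n (i + K n) x| := hvx.prod_factor n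
    have hsumr := (hr n).2.2 x ((summable_nat_add_iff (K n)).1 hfib)
    have heq : fs n x - (∑ i ∈ Finset.range (K n), r n i) x = ∑' i, r n (i + K n) x := by
      rw [← hsumr.tsum_eq, ← hsumr.summable.sum_add_tsum_nat_add (K n), Finset.sum_apply]
      ring
    rw [heq]
    have hnorm : Summable fun i => ‖r n (i + K n) x‖ := hfib
    calc |∑' i, r n (i + K n) x| ≤ ∑' i, |r n (i + K n) x| := norm_tsum_le_tsum_norm hnorm
      _ ≤ ∑' p, v p x := tsum_comp_le_tsum_of_inj hvx (fun p => hv0 p x)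
          (Prod.mk_right_injective n)

/-- Eventual smallness of the extended integrals along a non-increasing sequence in `U*`
tending to zero. -/
lemma eventually_abs_integralStar_le {fs : ℕ → X → ℝ} (hfs : ∀ n, fs n ∈ D.Ustar)
    (hmono : Antitone fs) (hlim : ∀ x, Tendsto (fun n => fs n x) atTop (𝓝 (0 : ℝ)))
    {ε : ℝ} (hε : 0 < ε) : ∀ᶠ n in atTop, |D.integralStar (fs n)| ≤ 8 * ε := by
  obtain ⟨h, w, hU, hwU, hw0, hwsum, hw2, hI, happ⟩ := D.exists_approx hfs hε
  obtain ⟨g, hg0, hgs⟩ : ∃ g : ℕ → X → ℝ, g 0 = h 0 ∧ ∀ n, g (n + 1) = g n ⊓ h (n + 1) :=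
    ⟨fun n => n.rec (h 0) fun k a => a ⊓ h (k + 1), rfl, fun _ => rfl⟩
  have hgU (n : ℕ) : g n ∈ D.U := by
    induction n with
    | zero => exact hg0 ▸ hU 0
    | succ n ih => exact hgs n ▸ D.inf_mem ih (hU _)
  have hganti : Antitone g := antitone_nat_of_succ_le fun n => hgs n ▸ inf_le_left
  have hgh (n : ℕ) : g n ≤ h n := by
    cases n with
    | zero => exact hg0.le
    | succ n => exact hgs n ▸ inf_le_right
  have hglow (x : X) (hx : Summable fun n => w n x) (n : ℕ) :
      fs n x - ∑' i, w i x ≤ g n x := by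
    have hh (n : ℕ) := (abs_le.1 (happ x hx n)).2
    induction n with
    | zero => rw [hg0]; linarith [hh 0]
    | succ n ih =>
      rw [hgs]
      exact le_min (by linarith [hmono n.le_succ x]) (by linarith [hh (n + 1)])
  have hupper := D.eventually_integral_le hgU hganti hwU hw0 hwsum (fun x hx δ hδ => by
    filter_upwards [(hlim x).eventually (gt_mem_nhds hδ)] with n hn
    linarith [hgh n x, (abs_le.1 (happ x hx n)).1]) hε
  filter_upwards [hupper] with n hn
  have hlow : D.integral (-h n) ≤ ∑' i, D.integral (w i) :=
    D.integral_le_tsum (D.neg_mem (hU n)) hwU hw0 hwsum fun x hx => by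
      have h0 : 0 ≤ fs n x :=
        Antitone.le_of_tendsto (f := fun n => fs n x) (fun _ _ hab => hmono hab x) (hlim x) n
      rw [Pi.neg_apply]
      linarith [(abs_le.1 (happ x hx n)).2]
  have hdiffU := D.sub_mem (hU n) (hgU n)
  have hdiff : D.integral ((1 / 2 : ℝ) • (h n - g n)) ≤ ∑' i, D.integral (w i) :=
    D.integral_le_tsum (D.smul_mem _ hdiffU) hwU hw0 hwsum fun x hx => by
      simp only [Pi.smul_apply, Pi.sub_apply, smul_eq_mul]
      linarith [(abs_le.1 (happ x hx n)).1, hglow x hx n]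
  rw [D.integral_smul _ hdiffU, D.integral_sub (hU n) (hgU n)] at hdiff
  rw [D.integral_neg (hU n)] at hlow
  have := abs_le.1 (hI n)
  exact abs_le.2 ⟨by linarith, by linarith⟩

end DaniellSpace

/-- Condition (II) holds on `𝒰*`: if `(fₙ)` in `𝒰*` is non-increasing pointwise with
`fₙ(x) → 0` everywhere, then `∫fₙ → 0`. -/
theorem daniell_Ustar_condition_II {X : Type*} [Nonempty X] (D : DaniellSpace X)
    (fs : ℕ → X → ℝ) (hfs : ∀ n, fs n ∈ D.Ustar) (hmono : Antitone fs)
    (hlim : ∀ x, Tendsto (fun n => fs n x) atTop (𝓝 (0 : ℝ))) :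
    Tendsto (fun n => D.integralStar (fs n)) atTop (𝓝 (0 : ℝ)) := by
  rw [Metric.tendsto_nhds]
  intro ε hε
  filter_upwards [D.eventually_abs_integralStar_le hfs hmono hlim (ε := ε / 9) (by positivity)]
    with n hn
  rw [Real.dist_eq, sub_zero]
  linarith
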